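/- Let $A$ be a cofibrant dg associative algebra and $B$ an augmented free dg associative algebra. Then the cohomology of the coproduct satisfies $H^\bullet(A \sqcup B) \cong H^\bullet(A)$, where $A \sqcup B = A * (B\langle x\rangle)^{-x}$ is the coproduct of curved (here dg) algebras. -/

import Mathlib

noncomputable section

/-- The grading of a free associative algebra by the total degree of words,
where the generator `y` has degree `degY y`. -/
def freeGrading (k Y : Type) [Field k] (degY : Y → ℤ) (n : ℤ) :
    Submodule k (FreeAlgebra k Y) :=
  Submodule.span k {b | ∃ w : List Y,
    (w.map (FreeAlgebra.ι k)).prod = b ∧ (w.map degY).sum = n}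

/-- A submodule of the free algebra which contains `1` and is stable under left
multiplication by the generators is everything. -/
theorem FreeAlgebra.submodule_mem_of_left {k Y : Type} [Field k]
    (Q : Submodule k (FreeAlgebra k Y)) (one : (1 : FreeAlgebra k Y) ∈ Q)
    (step : ∀ y, ∀ w ∈ Q, FreeAlgebra.ι k y * w ∈ Q) (c : FreeAlgebra k Y) : c ∈ Q := by
  have key : ∀ w ∈ Q, c * w ∈ Q := by
    induction c using FreeAlgebra.induction with
    | grade0 r => intro w hw; rw [← Algebra.smul_def]; exact Q.smul_mem r hw
    | grade1 y => exact step y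
    | mul a b ha hb => intro w hw; rw [mul_assoc]; exact ha _ (hb w hw)
    | add a b ha hb => intro w hw; rw [add_mul]; exact Q.add_mem (ha w hw) (hb w hw)
  simpa using key 1 one

/-- The action of the free algebra on pairs `(w, T w)`, for a linear operator `T` with
`T (y * w) = P y * w + q y * T w`. -/
def leftRecAction {k Y : Type} [Field k] (P q : Y → FreeAlgebra k Y) :
    FreeAlgebra k Y →ₐ[k] Module.End k (FreeAlgebra k Y × FreeAlgebra k Y) :=
  FreeAlgebra.lift k fun y =>
    (LinearMap.mulLeft k (FreeAlgebra.ι k y) ∘ₗ LinearMap.fst k _ _).prod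
      (LinearMap.mulLeft k (P y) ∘ₗ LinearMap.fst k _ _ +
        LinearMap.mulLeft k (q y) ∘ₗ LinearMap.snd k _ _)

theorem leftRecAction_fst {k Y : Type} [Field k] (P q : Y → FreeAlgebra k Y)
    (c : FreeAlgebra k Y) (v : FreeAlgebra k Y × FreeAlgebra k Y) :
    (leftRecAction P q c v).1 = c * v.1 := by
  induction c using FreeAlgebra.induction generalizing v with
  | grade0 r => simp [Module.algebraMap_end_apply, Algebra.smul_def]
  | grade1 y => simp [leftRecAction]
  | mul a b ha hb => simp [ha, hb, mul_assoc]
  | add a b ha hb => simp [ha, hb, add_mul]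

/-- A linear operator on a free algebra can be defined by recursion on the first letter. -/
theorem exists_leftRec {k Y : Type} [Field k] (P q : Y → FreeAlgebra k Y) :
    ∃ T : FreeAlgebra k Y →ₗ[k] FreeAlgebra k Y, T 1 = 0 ∧
      ∀ y w, T (FreeAlgebra.ι k y * w) = P y * w + q y * T w := by
  refine ⟨LinearMap.snd k _ _ ∘ₗ (LinearMap.applyₗ (1, 0)) ∘ₗ
    (leftRecAction P q).toLinearMap, by simp, fun y w => ?_⟩
  have h := leftRecAction_fst P q w (1, 0)
  simp only [LinearMap.comp_apply, AlgHom.toLinearMap_apply, LinearMap.applyₗ_apply_apply,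
    LinearMap.snd_apply, map_mul, Module.End.mul_apply]
  rw [leftRecAction, FreeAlgebra.lift_ι_apply, ← leftRecAction]
  simp [h]

theorem ι_mem_freeGrading {k Y : Type} [Field k] (deg : Y → ℤ) (y : Y) :
    FreeAlgebra.ι k y ∈ freeGrading k Y deg (deg y) :=
  Submodule.subset_span ⟨[y], by simp, by simp⟩

/-- If an operator passes each generator `y` with the sign of its degree, then it passes a
homogeneous element of degree `n` with the sign of `n`. -/
theorem map_mul_of_mem_freeGrading {k X R : Type} [Field k] [Ring R] [Algebra k R]
    (deg : X → ℤ) (j : FreeAlgebra k X →ₐ[k] R) (h : R →ₗ[k] R)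
    (hj : ∀ x w, h (j (FreeAlgebra.ι k x) * w) =
      ((deg x).negOnePow : ℤ) • (j (FreeAlgebra.ι k x) * h w))
    (n : ℤ) (a : FreeAlgebra k X) (ha : a ∈ freeGrading k X deg n) (w : R) :
    h (j a * w) = (n.negOnePow : ℤ) • (j a * h w) := by
  induction ha using Submodule.span_induction with
  | mem b hb =>
    obtain ⟨l, rfl, rfl⟩ := hb
    induction l with
    | nil => simp
    | cons x l ih =>
      simp only [List.map_cons, List.prod_cons, List.sum_cons, map_mul, mul_assoc, hj,
        Int.negOnePow_add, Units.val_mul] at ih ⊢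
      rw [ih, mul_smul_comm, mul_smul]
  | zero => simp
  | add b c _ _ hb hc => simp [add_mul, hb, hc]
  | smul r b _ hb => rw [map_smul, smul_mul_assoc, map_smul, hb, smul_mul_assoc, smul_comm]

/-- If `d h + h d = 1 - j p + N` with `N` locally nilpotent, and `h` vanishes on the image of
the chain map `j`, then every relative cocycle comes from the image of `j` up to a
coboundary. -/
theorem exists_eq_add_of_nilpotent_homotopy {k M R : Type} [Field k] [AddCommGroup M]
    [Module k M] [AddCommGroup R] [Module k R] (dM : M →ₗ[k] M) (d h N : R →ₗ[k] R)
    (j : M →ₗ[k] R) (p : R →ₗ[k] M) (hdj : ∀ a, d (j a) = j (dM a))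
    (hd : ∀ c, d (d c) = 0) (hh : ∀ a, h (j a) = 0)
    (hN : ∀ c, d (h c) + h (d c) = c - j (p c) + N c)
    (n : ℕ) (c : R) (hc : (N ^ n) c = 0) (b : M) (hb : d c = j b) :
    ∃ a c2, c = j a + d c2 := by
  induction n generalizing c b with
  | zero => exact ⟨0, 0, by simpa using hc⟩
  | succ n ih =>
    have hc' : c = j (p c) - N c + d (h c) := by
      have := hN c
      rw [hb, hh, add_zero] at this
      rw [this]; abel
    have hdN : d (N c) = j (dM (p c) - b) := by
      have := congrArg d hc'
      rw [map_add, map_sub, hd, hdj, hb] at this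
      rw [map_sub, this]; abel
    obtain ⟨a, c2, hac⟩ := ih (N c) (by rwa [pow_succ] at hc) _ hdN
    refine ⟨p c - a, h c - c2, ?_⟩
    rw [map_sub, map_sub]
    nth_rw 1 [hc', hac]
    abel

/-- Let `A` be a cofibrant (semifree) dg associative algebra
and `B` an augmented free dg associative algebra.  Then the inclusion of `A`
into the coproduct `A ⊔ B = A * (B⟨x⟩)^{-x}` of (curved, here dg) algebras is a
quasi-isomorphism: `H(A ⊔ B) ≅ H(A)`. -/
theorem cohomology_of_coproduct_with_augmented_free
    (k : Type) [Field k] [CharZero k]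
    -- A : free on XA, with a semifree (cofibrant) filtration rk
    (XA : Type) (degA : XA → ℤ) (rk : XA → ℕ)
    (dA : FreeAlgebra k XA →ₗ[k] FreeAlgebra k XA)
    (hdAdeg : ∀ (n : ℤ) (a : FreeAlgebra k XA), a ∈ freeGrading k XA degA n →
      dA a ∈ freeGrading k XA degA (n + 1))
    (hdAder : ∀ (n : ℤ) (a b : FreeAlgebra k XA), a ∈ freeGrading k XA degA n →
      dA (a * b) = dA a * b + (n.negOnePow : ℤ) • (a * dA b))
    (hdAsq : ∀ a, dA (dA a) = 0)
    (hdAfilt : ∀ a : XA, dA (FreeAlgebra.ι k a) ∈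
      Algebra.adjoin k (FreeAlgebra.ι k '' {b : XA | rk b < rk a}))
    -- B : free on XB, augmented
    (XB : Type) (degB : XB → ℤ)
    (dB : FreeAlgebra k XB →ₗ[k] FreeAlgebra k XB)
    (hdBdeg : ∀ (n : ℤ) (b : FreeAlgebra k XB), b ∈ freeGrading k XB degB n →
      dB b ∈ freeGrading k XB degB (n + 1))
    (hdBder : ∀ (n : ℤ) (a b : FreeAlgebra k XB), a ∈ freeGrading k XB degB n →
      dB (a * b) = dB a * b + (n.negOnePow : ℤ) • (a * dB b))
    (hdBsq : ∀ b, dB (dB b) = 0)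
    (εB : FreeAlgebra k XB →ₐ[k] k) (hεBd : ∀ b, εB (dB b) = 0)
    -- the coproduct A ⊔ B = A * B⟨x⟩ with a formal degree 1 generator x
    (jA : FreeAlgebra k XA →ₐ[k] FreeAlgebra k ((XA ⊕ XB) ⊕ Unit))
    (hjA : jA = FreeAlgebra.lift k (fun a : XA => FreeAlgebra.ι k (Sum.inl (Sum.inl a))))
    (jB : FreeAlgebra k XB →ₐ[k] FreeAlgebra k ((XA ⊕ XB) ⊕ Unit))
    (hjB : jB = FreeAlgebra.lift k (fun b : XB => FreeAlgebra.ι k (Sum.inl (Sum.inr b))))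
    (xg : FreeAlgebra k ((XA ⊕ XB) ⊕ Unit)) (hxg : xg = FreeAlgebra.ι k (Sum.inr ()))
    -- the twisted differential of the coproduct
    (dC : FreeAlgebra k ((XA ⊕ XB) ⊕ Unit) →ₗ[k] FreeAlgebra k ((XA ⊕ XB) ⊕ Unit))
    (hdCdeg : ∀ (n : ℤ) (c : FreeAlgebra k ((XA ⊕ XB) ⊕ Unit)),
      c ∈ freeGrading k ((XA ⊕ XB) ⊕ Unit) (Sum.elim (Sum.elim degA degB) fun _ => 1) n →
      dC c ∈ freeGrading k ((XA ⊕ XB) ⊕ Unit) (Sum.elim (Sum.elim degA degB) fun _ => 1) (n + 1))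
    (hdCder : ∀ (n : ℤ) (a b : FreeAlgebra k ((XA ⊕ XB) ⊕ Unit)),
      a ∈ freeGrading k ((XA ⊕ XB) ⊕ Unit) (Sum.elim (Sum.elim degA degB) fun _ => 1) n →
      dC (a * b) = dC a * b + (n.negOnePow : ℤ) • (a * dC b))
    (hdCsq : ∀ c, dC (dC c) = 0)
    (hdCA : ∀ a : FreeAlgebra k XA, dC (jA a) = jA (dA a))
    (hdCB : ∀ (n : ℤ) (b : FreeAlgebra k XB), b ∈ freeGrading k XB degB n →
      dC (jB b) = jB (dB b) - (xg * jB b - (n.negOnePow : ℤ) • (jB b * xg)))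
    (hdCx : dC xg = -(xg * xg)) :
    -- the inclusion jA : A → A ⊔ B is a quasi-isomorphism: H(A ⊔ B) ≅ H(A)
    (∀ a : FreeAlgebra k XA, dA a = 0 →
      (∃ c, jA a = dC c) → ∃ a2, a = dA a2) ∧
    (∀ c : FreeAlgebra k ((XA ⊕ XB) ⊕ Unit), dC c = 0 →
      ∃ (a : FreeAlgebra k XA) (c2 : FreeAlgebra k ((XA ⊕ XB) ⊕ Unit)),
        dA a = 0 ∧ c = jA a + dC c2) := by
  set s : XA → ℤ := fun a => ((degA a).negOnePow : ℤ) with hs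
  have hss : ∀ a, s a * s a = 1 := fun a => by
    rw [hs, ← Units.val_mul, Int.units_mul_self, Units.val_one]
  have jAι : ∀ a, jA (FreeAlgebra.ι k a) = FreeAlgebra.ι k (Sum.inl (Sum.inl a)) := by
    simp [hjA]
  have jBι : ∀ b, jB (FreeAlgebra.ι k b) = FreeAlgebra.ι k (Sum.inl (Sum.inr b)) := by
    simp [hjB]
  let p : FreeAlgebra k ((XA ⊕ XB) ⊕ Unit) →ₐ[k] FreeAlgebra k XA :=
    FreeAlgebra.lift k (Sum.elim (Sum.elim (FreeAlgebra.ι k) fun _ => 0) fun _ => 0)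
  have pA : ∀ a, p (jA (FreeAlgebra.ι k a)) = FreeAlgebra.ι k a := by simp [p, jAι]
  have pB : ∀ b, p (jB (FreeAlgebra.ι k b)) = 0 := by simp [p, jBι]
  have px : p xg = 0 := by simp [p, hxg]
  have pj : ∀ a, p (jA a) = a := by
    have : p.comp jA = AlgHom.id k _ := FreeAlgebra.hom_ext (funext pA)
    exact fun a => DFunLike.congr_fun this a
  -- the contracting homotopy
  obtain ⟨h, h1, hrec⟩ := exists_leftRec (k := k) (Y := (XA ⊕ XB) ⊕ Unit)
    (Sum.elim (fun _ => 0) fun _ => -1)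
    (Sum.elim (Sum.elim (fun a => s a • jA (FreeAlgebra.ι k a)) fun _ => 0) fun _ => 0)
  have hA : ∀ a w, h (jA (FreeAlgebra.ι k a) * w) = s a • (jA (FreeAlgebra.ι k a) * h w) := by
    intro a w
    nth_rw 1 [jAι]
    simp [hrec, mul_assoc]
  have hB : ∀ b w, h (jB (FreeAlgebra.ι k b) * w) = 0 := by
    intro b w; rw [jBι]; simp [hrec]
  have hx : ∀ w, h (xg * w) = -w := by intro w; rw [hxg]; simp [hrec]
  have hjA0 : ∀ a, h (jA a) = 0 := by
    intro a
    refine FreeAlgebra.submodule_mem_of_left (LinearMap.ker (h ∘ₗ jA.toLinearMap))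
      (by simp [h1]) (fun y w hw => ?_) a
    simp only [LinearMap.mem_ker, LinearMap.comp_apply, AlgHom.toLinearMap_apply] at hw ⊢
    simp [hA, hw]
  have hjB0 : ∀ b w, h (jB b * w) = FreeAlgebra.algebraMapInv b • h w := by
    intro b
    induction b using FreeAlgebra.induction with
    | grade0 r => intro w; simp [← Algebra.smul_def, FreeAlgebra.algebraMapInv]
    | grade1 y => intro w; simp [hB, FreeAlgebra.algebraMapInv]
    | mul a b ha hb => intro w; rw [map_mul jB, mul_assoc, ha, hb, map_mul, mul_smul]
    | add a b ha hb => intro w; rw [map_add, add_mul, map_add, ha, hb, map_add, add_smul]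
  -- the differential on words
  have d1 : dC 1 = 0 := by
    have := hdCder 0 1 1 (Submodule.subset_span ⟨[], by simp, by simp⟩)
    simpa using this
  have dA' : ∀ a w, dC (jA (FreeAlgebra.ι k a) * w) =
      jA (dA (FreeAlgebra.ι k a)) * w + s a • (jA (FreeAlgebra.ι k a) * dC w) := by
    intro a w
    rw [← hdCA]
    exact hdCder (degA a) _ w (jAι a ▸ ι_mem_freeGrading _ (Sum.inl (Sum.inl a)))
  have dB' : ∀ b w, dC (jB (FreeAlgebra.ι k b) * w) =
      (jB (dB (FreeAlgebra.ι k b)) - (xg * jB (FreeAlgebra.ι k b) -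
        ((degB b).negOnePow : ℤ) • (jB (FreeAlgebra.ι k b) * xg))) * w +
      ((degB b).negOnePow : ℤ) • (jB (FreeAlgebra.ι k b) * dC w) := by
    intro b w
    rw [← hdCB (degB b) _ (ι_mem_freeGrading degB b)]
    exact hdCder (degB b) _ w (jBι b ▸ ι_mem_freeGrading _ (Sum.inl (Sum.inr b)))
  have dx' : ∀ w, dC (xg * w) = -(xg * (xg * w)) - xg * dC w := by
    intro w
    rw [hdCder 1 xg w (hxg ▸ ι_mem_freeGrading _ (Sum.inr ())), hdCx]
    simp [mul_assoc, sub_eq_add_neg]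
  have hdA' : ∀ a w, h (jA (dA (FreeAlgebra.ι k a)) * w) =
      -(s a • (jA (dA (FreeAlgebra.ι k a)) * h w)) := by
    intro a w
    rw [map_mul_of_mem_freeGrading degA jA h hA _ _
      (hdAdeg _ _ (ι_mem_freeGrading degA a)) w, Int.negOnePow_succ]
    simp [hs]
  -- the defect of the homotopy
  let N : FreeAlgebra k ((XA ⊕ XB) ⊕ Unit) →ₗ[k] FreeAlgebra k ((XA ⊕ XB) ⊕ Unit) :=
    dC ∘ₗ h + h ∘ₗ dC - LinearMap.id + jA.toLinearMap ∘ₗ p.toLinearMap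
  have Ndef : ∀ c, N c = dC (h c) + h (dC c) - c + jA (p c) := fun c => by simp [N]
  have N1 : N 1 = 0 := by simp [Ndef, h1, d1]
  have NA : ∀ a w, N (jA (FreeAlgebra.ι k a) * w) = jA (FreeAlgebra.ι k a) * N w := by
    intro a w
    simp only [Ndef, hA, dA', map_add, map_zsmul, hdA', map_mul, pA, smul_add, smul_smul, hss,
      one_smul, mul_add, mul_sub]
    abel
  have NB : ∀ b w, N (jB (FreeAlgebra.ι k b) * w) =
      FreeAlgebra.algebraMapInv (dB (FreeAlgebra.ι k b)) • h w := by
    intro b w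
    simp only [Ndef, hB, dB', map_add, map_sub, map_zsmul, sub_mul, smul_mul_assoc, mul_assoc,
      hx, hjB0, map_mul, pB, zero_mul, map_zero, smul_zero]
    abel
  have Nx : ∀ w, N (xg * w) = 0 := by
    intro w
    simp only [Ndef, hx, dx', map_sub, map_neg, map_mul, px, zero_mul, map_zero]
    abel
  have NpowA : ∀ n a w, (N ^ n) (jA (FreeAlgebra.ι k a) * w) =
      jA (FreeAlgebra.ι k a) * (N ^ n) w := by
    intro n a
    induction n with
    | zero => simp
    | succ n ih => intro w; simp only [pow_succ, Module.End.mul_apply, NA, ih]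
  have hnil : ∀ c, ∃ n : ℕ, (N ^ n) c = 0 := by
    have memM : ∀ c, c ∈ Module.End.maxGenEigenspace N 0 ↔ ∃ n : ℕ, (N ^ n) c = 0 := by
      intro c; simp [Module.End.mem_maxGenEigenspace]
    have MA : ∀ a, ∀ w ∈ Module.End.maxGenEigenspace N 0,
        jA (FreeAlgebra.ι k a) * w ∈ Module.End.maxGenEigenspace N 0 := by
      intro a w hw
      obtain ⟨n, hn⟩ := (memM w).1 hw
      exact (memM _).2 ⟨n, by rw [NpowA, hn, mul_zero]⟩
    have MN : ∀ c, N c ∈ Module.End.maxGenEigenspace N 0 →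
        c ∈ Module.End.maxGenEigenspace N 0 := by
      intro c hc
      obtain ⟨n, hn⟩ := (memM _).1 hc
      exact (memM _).2 ⟨n + 1, by rwa [pow_succ]⟩
    intro c
    refine (memM c).1 (FreeAlgebra.submodule_mem_of_left
      (Module.End.maxGenEigenspace N 0 ⊓ (Module.End.maxGenEigenspace N 0).comap h)
      ⟨MN _ (by rw [N1]; exact zero_mem _), by simp [h1]⟩ ?_ c).1
    rintro ((a | b) | ⟨⟩) w ⟨hw, hw'⟩
    · rw [← jAι]
      refine ⟨MA a w hw, ?_⟩
      rw [SetLike.mem_coe, Submodule.mem_comap, hA]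
      exact zsmul_mem (MA a _ hw') _
    · rw [← jBι]
      refine ⟨MN _ ?_, ?_⟩
      · rw [NB]
        exact Submodule.smul_mem _ _ hw'
      · rw [SetLike.mem_coe, Submodule.mem_comap, hB]
        exact zero_mem _
    · rw [← hxg]
      refine ⟨MN _ ?_, ?_⟩
      · rw [Nx]
        exact zero_mem _
      · rw [SetLike.mem_coe, Submodule.mem_comap, hx]
        exact neg_mem hw
  have main : ∀ c b, dC c = jA b → ∃ a c2, c = jA a + dC c2 := by
    intro c b hcb
    obtain ⟨n, hn⟩ := hnil c
    exact exists_eq_add_of_nilpotent_homotopy dA dC h N jA.toLinearMap p.toLinearMap hdCA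
      hdCsq hjA0 (fun c => by simp [Ndef]) n c hn b hcb
  have jA_inj : Function.Injective jA := Function.LeftInverse.injective pj
  constructor
  · rintro a - ⟨c, hc⟩
    obtain ⟨a', c2, rfl⟩ := main c a hc.symm
    refine ⟨a', jA_inj ?_⟩
    rw [hc, map_add, hdCsq, add_zero, hdCA]
  · intro c hc
    obtain ⟨a, c2, rfl⟩ := main c 0 (by rw [hc, map_zero])
    refine ⟨a, c2, jA_inj ?_, rfl⟩
    rw [map_add, hdCsq, add_zero, hdCA] at hc
    rw [hc, map_zero]

end
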